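/- For every $0 < \varepsilon < a$ and every $n\in\mathbb{N}$, the $\varepsilon$-width dimension of the cube $([0,a]^n, \|\cdot\|_\infty)$ equals $n$: $\mathrm{Wdim}_\varepsilon([0,a]^n, \|\cdot\|_\infty) = n$. -/

import Mathlib

open scoped Topology

/-- Covering dimension at most `n`: every open cover admits an open refinement (indexed
by the same set, allowing empty members) of multiplicity at most `n + 1`. -/
def CovDimLE (P : Type) [TopologicalSpace P] (n : ℕ) : Prop :=
  ∀ (ι : Type) (U : ι → Set P), (∀ i, IsOpen (U i)) → (⋃ i, U i) = Set.univ →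
    ∃ V : ι → Set P, (∀ i, IsOpen (V i)) ∧ (∀ i, V i ⊆ U i) ∧
      (⋃ i, V i) = Set.univ ∧
      ∀ x : P, {i | x ∈ V i}.Finite ∧ {i | x ∈ V i}.ncard ≤ n + 1

/-- `Wdim_ε(X, d) ≤ n`: there is a continuous map `f` from `X` into a polyhedron
(formalized here as a compact metrizable space) of covering dimension at most `n`
which is an `(ε, d)`-embedding, i.e. all fibers of `f` have diameter `< ε`. -/
def WdimLE (X : Type*) [MetricSpace X] (ε : ℝ) (n : ℕ) : Prop :=
  ∃ (P : Type) (_ : TopologicalSpace P), CompactSpace P ∧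
    TopologicalSpace.MetrizableSpace P ∧ CovDimLE P n ∧
    ∃ f : X → P, Continuous f ∧ ∀ y : P, Metric.diam (f ⁻¹' {y}) < ε

/-- `Wdim_ε(X, d)`, the minimal dimension of a polyhedron admitting an
`(ε, d)`-embedding of `X` (as an extended natural number; `⊤` if none exists). -/
noncomputable def Wdim (X : Type*) [MetricSpace X] (ε : ℝ) : ℕ∞ :=
  sInf {m : ℕ∞ | ∃ n : ℕ, m = n ∧ WdimLE X ε n}

/-- A labelling of `n + 1` vertices is full if it takes all the values `0, …, n`. -/
def FullLabels {n : ℕ} (L : Fin (n + 1) → ℕ) : Prop :=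
  ∀ j ≤ n, ∃ k, L k = j

/-- The `k`-th vertex of the Kuhn simplex in the unit cube with lowest corner `b`
determined by the permutation `τ`. -/
def kuhnVertex {n : ℕ} (b : Fin n → ℤ) (τ : Equiv.Perm (Fin n)) (k : Fin (n + 1)) :
    Fin n → ℤ :=
  fun i => b i + if (k : ℕ) ≤ τ i then 1 else 0

theorem FullLabels.injective_and_le {n : ℕ} {L : Fin (n + 1) → ℕ} (h : FullLabels L) :
    Function.Injective L ∧ ∀ k, L k ≤ n := by
  choose g hg using fun j : Fin (n + 1) => h j (Nat.lt_succ_iff.1 j.2)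
  have hinj : Function.Injective g := fun x y hxy => by
    have := hg x
    rw [hxy, hg y] at this
    exact Fin.ext this.symm
  have hsurj := Finite.injective_iff_surjective.1 hinj
  refine ⟨fun x y hxy => ?_, fun k => ?_⟩
  · obtain ⟨x, rfl⟩ := hsurj x
    obtain ⟨y, rfl⟩ := hsurj y
    rw [hg, hg] at hxy
    rw [Fin.ext hxy]
  · obtain ⟨x, rfl⟩ := hsurj k
    rw [hg]
    omega

open Classical in
theorem sum_fullLabels_facets {n : ℕ} (L : Fin (n + 2) → ℕ) (hL : ∀ k, L k ≤ n + 1) :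
    ∑ m : Fin (n + 2), (if FullLabels (L ∘ m.succAbove) then 1 else 0 : ZMod 2) =
      if FullLabels L then 1 else 0 := by
  by_cases hd : ∃ m : Fin (n + 2), FullLabels (L ∘ m.succAbove)
  · obtain ⟨m, hm⟩ := hd
    obtain ⟨hinj, hle⟩ := hm.injective_and_le
    have hle' : ∀ k, k ≠ m → L k ≤ n := fun k hk => by
      obtain ⟨j, rfl⟩ := Fin.exists_succAbove_eq hk
      exact hle j
    have hinj' : ∀ k l, k ≠ m → l ≠ m → L k = L l → k = l := fun k l hk hl h => by
      obtain ⟨j, rfl⟩ := Fin.exists_succAbove_eq hk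
      obtain ⟨j', rfl⟩ := Fin.exists_succAbove_eq hl
      rw [hinj h]
    by_cases hmn : L m = n + 1
    · have hfull : FullLabels L := fun j hj => by
        rcases Nat.lt_or_ge n j with h | h
        · exact ⟨m, by omega⟩
        · obtain ⟨k, hk⟩ := hm j h
          exact ⟨_, hk⟩
      rw [if_pos hfull, Finset.sum_eq_single m, if_pos hm]
      · intro k _ hk
        rw [if_neg]
        intro hf
        obtain ⟨j, hj⟩ := Fin.exists_succAbove_eq hk.symm
        have := hf.injective_and_le.2 j
        simp only [Function.comp, hj] at this
        omega
      · simp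
    · obtain ⟨k, hk⟩ := hm (L m) (by have := hL m; omega)
      simp only [Function.comp] at hk
      have hkm := Fin.succAbove_ne m k
      set m' := m.succAbove k
      have hnf : ¬ FullLabels L := fun hf => hkm (hf.injective_and_le.1 hk)
      have hm' : FullLabels (L ∘ m'.succAbove) := fun j hj => by
        obtain ⟨l, hl⟩ := hm j hj
        simp only [Function.comp] at hl
        by_cases h : m.succAbove l = m'
        · obtain ⟨q, hq⟩ := Fin.exists_succAbove_eq hkm.symm
          exact ⟨q, by simp only [Function.comp, hq]; rw [← hk, ← h, hl]⟩
        · obtain ⟨q, hq⟩ := Fin.exists_succAbove_eq h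
          exact ⟨q, by simp only [Function.comp, hq, hl]⟩
      rw [if_neg hnf, ← Finset.sum_subset (Finset.subset_univ {m, m'}),
        Finset.sum_pair hkm.symm, if_pos hm, if_pos hm']
      · exact CharTwo.add_self_eq_zero _
      · intro q _ hq
        simp only [Finset.mem_insert, Finset.mem_singleton, not_or] at hq
        rw [if_neg]
        intro hf
        obtain ⟨x, hx⟩ := Fin.exists_succAbove_eq (Ne.symm hq.1)
        obtain ⟨y, hy⟩ := Fin.exists_succAbove_eq (Ne.symm hq.2)
        have : x = y := hf.injective_and_le.1 (by simp only [Function.comp, hx, hy, hk])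
        exact hkm (by rw [← hx, ← hy, this])
  · have hnf : ¬ FullLabels L := fun hf => by
      obtain ⟨m, hm⟩ := hf (n + 1) le_rfl
      refine hd ⟨m, fun j hj => ?_⟩
      obtain ⟨k, hk⟩ := hf j (by omega)
      obtain ⟨q, hq⟩ := Fin.exists_succAbove_eq (show k ≠ m by rintro rfl; omega)
      exact ⟨q, by simp only [Function.comp, hq, hk]⟩
    rw [if_neg hnf]
    exact Finset.sum_eq_zero fun m _ => if_neg fun h => hd ⟨m, h⟩

theorem kuhnVertex_swap {n : ℕ} (b : Fin (n + 1) → ℤ) (τ : Equiv.Perm (Fin (n + 1)))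
    (j : Fin n) (k : Fin (n + 1)) :
    kuhnVertex b (Equiv.swap j.castSucc j.succ * τ) (j.succ.castSucc.succAbove k) =
      kuhnVertex b τ (j.succ.castSucc.succAbove k) := by
  have hne := Fin.val_ne_of_ne (Fin.succAbove_ne j.succ.castSucc k)
  set q := j.succ.castSucc.succAbove k
  funext i
  simp only [kuhnVertex, Equiv.Perm.mul_apply]
  congr 1
  refine if_congr ?_ rfl rfl
  simp only [Fin.val_castSucc, Fin.val_succ] at hne
  rw [Equiv.swap_apply_def]
  split_ifs with h1 h2
  · rw [h1]; simp; omega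
  · rw [h2]; simp; omega
  · rfl

theorem kuhnVertex_rotate {n : ℕ} (b : Fin (n + 1) → ℤ) (τ : Equiv.Perm (Fin (n + 1)))
    (k : Fin (n + 1)) :
    kuhnVertex b ((finRotate (n + 1))⁻¹ * τ) k.castSucc =
      kuhnVertex (b + Pi.single (τ⁻¹ 0) 1) τ k.succ := by
  obtain ⟨ρ, rfl⟩ : ∃ ρ, τ = finRotate (n + 1) * ρ :=
    ⟨(finRotate (n + 1))⁻¹ * τ, by group⟩
  funext i
  have h0 : (finRotate (n + 1) * ρ)⁻¹ 0 = ρ⁻¹ (Fin.last n) := by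
    rw [Equiv.Perm.inv_eq_iff_eq]
    simp
  rw [h0]
  simp only [kuhnVertex, inv_mul_cancel_left, Equiv.Perm.mul_apply, Pi.add_apply,
    coe_finRotate, Fin.val_castSucc, Fin.val_succ]
  by_cases hi : ρ i = Fin.last n
  · have : i = ρ⁻¹ (Fin.last n) := by rw [← hi]; simp
    subst this
    have := k.2
    simp
    omega
  · have : i ≠ ρ⁻¹ (Fin.last n) := fun h => hi (by rw [h]; simp)
    rw [if_neg hi, Pi.single_eq_of_ne this]
    simp

open Classical in
theorem kuhn_ends {n N : ℕ} (ℓ : (Fin (n + 1) → ℤ) → ℕ)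
    (hN : ∀ v : Fin (n + 1) → ℤ, (∀ i, 0 ≤ v i ∧ v i ≤ N) →
      ∀ j : Fin (n + 1), v j = N → ℓ v + j + 1 ≠ n + 1)
    (τ : Equiv.Perm (Fin (n + 1))) :
    (∑ b ∈ Fintype.piFinset fun _ : Fin (n + 1) => Finset.Ico (0 : ℤ) N,
        (if FullLabels (fun k : Fin (n + 1) => ℓ (kuhnVertex b τ k.succ)) then 1 else 0 : ZMod 2)) +
      ∑ b ∈ Fintype.piFinset fun _ : Fin (n + 1) => Finset.Ico (0 : ℤ) N,
        (if FullLabels (fun k : Fin (n + 1) =>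
          ℓ (kuhnVertex b ((finRotate (n + 1))⁻¹ * τ) k.castSucc)) then 1 else 0 : ZMod 2) =
    ∑ b ∈ (Fintype.piFinset fun _ : Fin (n + 1) => Finset.Ico (0 : ℤ) N).filter
        (fun b => b (τ⁻¹ 0) = 0),
      (if FullLabels (fun k : Fin (n + 1) => ℓ (kuhnVertex b τ k.succ)) then 1 else 0 : ZMod 2) := by
  simp only [kuhnVertex_rotate]
  have hτi : τ (τ⁻¹ 0) = 0 := by simp
  set i := τ⁻¹ 0
  set B := Fintype.piFinset fun _ : Fin (n + 1) => Finset.Ico (0 : ℤ) N with hB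
  set G : (Fin (n + 1) → ℤ) → ZMod 2 := fun b =>
    if FullLabels (fun k : Fin (n + 1) => ℓ (kuhnVertex b τ k.succ)) then 1 else 0
  have hmem : ∀ b, b ∈ B ↔ ∀ j, 0 ≤ b j ∧ b j < N := by simp [hB]
  change ∑ b ∈ B, G b + ∑ b ∈ B, G (b + Pi.single i 1) = ∑ b ∈ B with b i = 0, G b
  have hG0 : ∀ b ∈ B, b i + 1 = N → G (b + Pi.single i 1) = 0 := by
    intro b hb hbi
    rw [hmem] at hb
    refine if_neg fun hf => ?_
    obtain ⟨k, hk⟩ := hf (n - i) (by omega)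
    beta_reduce at hk
    refine hN _ (fun j => ?_) i ?_ (by rw [hk]; omega)
    · have hj := hb j
      simp only [kuhnVertex, Pi.add_apply]
      by_cases hji : j = i
      · subst hji
        rw [Pi.single_eq_same, hτi, if_neg (by simp)]
        omega
      · simp only [Pi.single_apply, hji, if_false]
        split_ifs <;> omega
    · simp only [kuhnVertex, Pi.add_apply]
      rw [Pi.single_eq_same, hτi, if_neg (by simp), hbi, add_zero]
  have hlow : ∑ b ∈ B, G b = ∑ b ∈ B with b i = 0, G b + ∑ b ∈ B with ¬ b i = 0, G b :=
    (Finset.sum_filter_add_sum_filter_not B (fun b => b i = 0) G).symm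
  have hhigh : ∑ b ∈ B, G (b + Pi.single i 1) =
      ∑ b ∈ B with ¬ b i + 1 = (N : ℤ), G (b + Pi.single i 1) := by
    refine (Finset.sum_filter_of_ne (p := fun b => ¬ b i + 1 = (N : ℤ)) fun b hb hne h =>
      hne (hG0 b hb h)).symm
  have : ∑ b ∈ B with ¬ b i + 1 = (N : ℤ), G (b + Pi.single i 1) = ∑ b ∈ B with ¬ b i = 0, G b := by
    refine Finset.sum_nbij' (fun b => b + Pi.single i 1) (fun b => b - Pi.single i 1) ?_ ?_ ?_ ?_ ?_
    · intro b hb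
      simp only [Finset.mem_filter, hmem, Pi.add_apply, Pi.single_apply] at hb ⊢
      refine ⟨fun j => ?_, ?_⟩
      · have := hb.1 j
        split_ifs with h
        · subst h; omega
        · omega
      · have := hb.1 i
        simp; omega
    · intro b hb
      simp only [Finset.mem_filter, hmem, Pi.sub_apply, Pi.single_apply] at hb ⊢
      refine ⟨fun j => ?_, ?_⟩
      · have := hb.1 j
        split_ifs with h
        · subst h; omega
        · omega
      · have := hb.1 i
        simp; omega
    · intro b _; simp
    · intro b _; simp
    · intro b _; rfl
  rw [hlow, hhigh, this, add_assoc, CharTwo.add_self_eq_zero, add_zero]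

open Classical in
theorem kuhn_bottom {n N : ℕ} (hNpos : 0 < N) (ℓ : (Fin (n + 1) → ℤ) → ℕ)
    (h0 : ∀ v : Fin (n + 1) → ℤ, (∀ i, 0 ≤ v i ∧ v i ≤ N) →
      ∀ j : Fin (n + 1), v j = 0 → ℓ v + j + 1 ≤ n + 1) :
    ∑ τ : Equiv.Perm (Fin (n + 1)),
      ∑ b ∈ (Fintype.piFinset fun _ : Fin (n + 1) => Finset.Ico (0 : ℤ) N).filter
        (fun b => b (τ⁻¹ 0) = 0),
      (if FullLabels (fun k : Fin (n + 1) => ℓ (kuhnVertex b τ k.succ)) then 1 else 0 : ZMod 2) =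
    ∑ τ : Equiv.Perm (Fin n),
      ∑ b ∈ Fintype.piFinset fun _ : Fin n => Finset.Ico (0 : ℤ) N,
      (if FullLabels (fun k : Fin (n + 1) => ℓ (Fin.cons 0 (kuhnVertex b τ k)))
        then 1 else 0 : ZMod 2) := by
  rw [← Equiv.sum_comp Equiv.Perm.decomposeFin.symm, Fintype.sum_prod_type,
    Finset.sum_eq_single 0 _ (by simp)]
  · refine Finset.sum_congr rfl fun τ _ => ?_
    set ρ := Equiv.Perm.decomposeFin.symm (0, τ) with hρ
    have hρ0 : ρ 0 = 0 := by simp [hρ]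
    have hρs : ∀ i, ρ (Fin.succ i) = (τ i).succ := by simp [hρ]
    have hρi : ρ⁻¹ 0 = 0 := by rw [Equiv.Perm.inv_eq_iff_eq, hρ0]
    rw [hρi]
    refine Finset.sum_nbij' (fun b => Fin.tail b) (fun b => Fin.cons 0 b) ?_ ?_ ?_ ?_ ?_
    · intro b hb
      simp only [Finset.mem_filter, Fintype.mem_piFinset] at hb ⊢
      exact fun i => hb.1 i.succ
    · intro b hb
      simp only [Finset.mem_filter, Fintype.mem_piFinset] at hb ⊢
      refine ⟨fun i => ?_, rfl⟩
      refine Fin.cases ?_ (fun i => ?_) i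
      · simpa using hNpos
      · exact hb i
    · intro b hb
      rw [← (Finset.mem_filter.1 hb).2, Fin.cons_self_tail]
    · intro b _; simp
    · intro b hb
      have hb0 := (Finset.mem_filter.1 hb).2
      have : ∀ k : Fin (n + 1), kuhnVertex b ρ k.succ = Fin.cons 0 (kuhnVertex (Fin.tail b) τ k) := by
        intro k
        funext i
        refine Fin.cases ?_ (fun i => ?_) i
        · simp [kuhnVertex, hρ0, hb0]
        · simp [kuhnVertex, hρs, Fin.tail]
      simp only [this]
  · intro p _ hp
    refine Finset.sum_eq_zero fun τ _ => Finset.sum_eq_zero fun b hb => if_neg fun hf => ?_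
    set ρ := Equiv.Perm.decomposeFin.symm (p, τ) with hρ
    have hρ0 : ρ 0 = p := by simp [hρ]
    have hi : ρ⁻¹ 0 ≠ 0 := fun h => hp (by rw [Equiv.Perm.inv_eq_iff_eq, hρ0] at h; exact h.symm)
    obtain ⟨hb, hb0⟩ := Finset.mem_filter.1 hb
    obtain ⟨k, hk⟩ := hf n le_rfl
    beta_reduce at hk
    have := h0 (kuhnVertex b ρ k.succ) (fun j => ?_) (ρ⁻¹ 0) (by
      simp only [kuhnVertex, hb0, zero_add]
      rw [show ρ (ρ⁻¹ 0) = 0 by simp, if_neg (by simp)])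
    · rw [hk] at this
      exact hi (Fin.ext (by rw [Fin.val_zero]; omega))
    · have := Finset.mem_Ico.1 (Fintype.mem_piFinset.1 hb j)
      simp only [kuhnVertex]
      split_ifs <;> omega

open Classical in
theorem kuhn_parity {N : ℕ} (hNpos : 0 < N) (n : ℕ) (ℓ : (Fin n → ℤ) → ℕ)
    (hle : ∀ v : Fin n → ℤ, (∀ i, 0 ≤ v i ∧ v i ≤ N) → ℓ v ≤ n)
    (h0 : ∀ v : Fin n → ℤ, (∀ i, 0 ≤ v i ∧ v i ≤ N) → ∀ j : Fin n, v j = 0 → ℓ v + j + 1 ≤ n)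
    (hN : ∀ v : Fin n → ℤ, (∀ i, 0 ≤ v i ∧ v i ≤ N) → ∀ j : Fin n, v j = N → ℓ v + j + 1 ≠ n) :
    ∑ τ : Equiv.Perm (Fin n), ∑ b ∈ Fintype.piFinset fun _ : Fin n => Finset.Ico (0 : ℤ) N,
      (if FullLabels (fun k => ℓ (kuhnVertex b τ k)) then 1 else 0 : ZMod 2) = 1 := by
  induction n with
  | zero =>
    have hf : ∀ (b : Fin 0 → ℤ) (τ : Equiv.Perm (Fin 0)),
        FullLabels (fun k => ℓ (kuhnVertex b τ k)) := fun b τ j hj =>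
      ⟨0, by have := hle (kuhnVertex b τ 0) (fun i => i.elim0); beta_reduce; omega⟩
    simp [hf]
  | succ n ih =>
    have key := ih (fun v => ℓ (Fin.cons 0 v)) ?_ ?_ ?_
    rotate_left
    · intro v hv
      have := h0 (Fin.cons 0 v) (fun i => ?_) 0 rfl
      · simpa using this
      · refine Fin.cases (by simp) (fun i => ?_) i
        simpa using hv i
    · intro v hv j hj
      have := h0 (Fin.cons 0 v) (fun i => ?_) j.succ hj
      · simp at this; omega
      · refine Fin.cases (by simp) (fun i => ?_) i
        simpa using hv i
    · intro v hv j hj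
      have := hN (Fin.cons 0 v) (fun i => ?_) j.succ hj
      · simp at this; omega
      · refine Fin.cases (by simp) (fun i => ?_) i
        simpa using hv i
    rw [← kuhn_bottom hNpos ℓ h0, ← Finset.sum_congr rfl fun τ _ => kuhn_ends ℓ hN τ,
      Finset.sum_add_distrib] at key
    have hrot : ∑ τ : Equiv.Perm (Fin (n + 1)),
        ∑ b ∈ Fintype.piFinset fun _ : Fin (n + 1) => Finset.Ico (0 : ℤ) N,
        (if FullLabels (fun k : Fin (n + 1) =>
          ℓ (kuhnVertex b ((finRotate (n + 1))⁻¹ * τ) k.castSucc)) then 1 else 0 : ZMod 2) =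
        ∑ τ : Equiv.Perm (Fin (n + 1)),
        ∑ b ∈ Fintype.piFinset fun _ : Fin (n + 1) => Finset.Ico (0 : ℤ) N,
        (if FullLabels (fun k : Fin (n + 1) => ℓ (kuhnVertex b τ k.castSucc))
          then 1 else 0 : ZMod 2) :=
      Equiv.sum_comp (Equiv.mulLeft (finRotate (n + 1))⁻¹) fun τ =>
        ∑ b ∈ Fintype.piFinset fun _ : Fin (n + 1) => Finset.Ico (0 : ℤ) N,
        (if FullLabels (fun k : Fin (n + 1) => ℓ (kuhnVertex b τ k.castSucc))
          then 1 else 0 : ZMod 2)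
    rw [hrot] at key
    have hfacets : ∀ τ : Equiv.Perm (Fin (n + 1)),
        ∀ b ∈ Fintype.piFinset fun _ : Fin (n + 1) => Finset.Ico (0 : ℤ) N,
        (if FullLabels (fun k => ℓ (kuhnVertex b τ k)) then 1 else 0 : ZMod 2) =
        (if FullLabels (fun k : Fin (n + 1) => ℓ (kuhnVertex b τ k.succ)) then 1 else 0) +
        (∑ j : Fin n, if FullLabels (fun k => ℓ (kuhnVertex b τ (j.succ.castSucc.succAbove k)))
          then 1 else 0) +
        (if FullLabels (fun k : Fin (n + 1) => ℓ (kuhnVertex b τ k.castSucc)) then 1 else 0) := by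
      intro τ b hb
      rw [← sum_fullLabels_facets _ fun k => hle _ fun j => ?_, Fin.sum_univ_castSucc,
        Fin.sum_univ_succ]
      · simp only [Function.comp_def, Fin.castSucc_zero, Fin.succAbove_zero, Fin.succAbove_last]
        rfl
      · have := Finset.mem_Ico.1 (Fintype.mem_piFinset.1 hb j)
        simp only [kuhnVertex]
        split_ifs <;> omega
    have hmid : ∑ τ : Equiv.Perm (Fin (n + 1)),
        ∑ b ∈ Fintype.piFinset fun _ : Fin (n + 1) => Finset.Ico (0 : ℤ) N, ∑ j : Fin n,
        (if FullLabels (fun k => ℓ (kuhnVertex b τ (j.succ.castSucc.succAbove k)))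
          then 1 else 0 : ZMod 2) = 0 := by
      rw [Finset.sum_comm]
      refine Finset.sum_eq_zero fun b _ => ?_
      rw [Finset.sum_comm]
      refine Finset.sum_eq_zero fun j _ => ?_
      refine Finset.sum_involution (fun τ _ => Equiv.swap j.castSucc j.succ * τ) ?_ ?_ ?_ ?_
      · intro τ _
        simp only [kuhnVertex_swap]
        exact CharTwo.add_self_eq_zero _
      · intro τ _ _ h
        have := Equiv.swap_eq_one_iff.1 (mul_eq_right.1 h)
        exact (Fin.castSucc_lt_succ (i := j)).ne this
      · simp
      · intro τ _
        rw [Equiv.swap_mul_self_mul]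
    rw [Finset.sum_congr rfl fun τ _ => Finset.sum_congr rfl (hfacets τ)]
    simp only [Finset.sum_add_distrib]
    rw [hmid, add_zero]
    exact key

/-- **Kuhn's lemma**, a cubical version of Sperner's lemma. -/
theorem kuhn_exists_full {N : ℕ} (hNpos : 0 < N) (n : ℕ) (ℓ : (Fin n → ℤ) → ℕ)
    (hle : ∀ v : Fin n → ℤ, (∀ i, 0 ≤ v i ∧ v i ≤ N) → ℓ v ≤ n)
    (h0 : ∀ v : Fin n → ℤ, (∀ i, 0 ≤ v i ∧ v i ≤ N) → ∀ j : Fin n, v j = 0 → ℓ v + j + 1 ≤ n)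
    (hN : ∀ v : Fin n → ℤ, (∀ i, 0 ≤ v i ∧ v i ≤ N) → ∀ j : Fin n, v j = N → ℓ v + j + 1 ≠ n) :
    ∃ b : Fin n → ℤ, (∀ i, 0 ≤ b i ∧ b i ≤ N) ∧ ∀ j ≤ n, ∃ v : Fin n → ℤ,
      (∀ i, 0 ≤ v i ∧ v i ≤ N) ∧ (∀ i, |b i - v i| ≤ 1) ∧ ℓ v = j := by
  classical
  have h := kuhn_parity hNpos n ℓ hle h0 hN
  obtain ⟨τ, -, hτ⟩ := Finset.exists_ne_zero_of_sum_ne_zero (h.trans_ne one_ne_zero)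
  obtain ⟨b, hb, hf⟩ := Finset.exists_ne_zero_of_sum_ne_zero hτ
  have hf' : FullLabels (fun k => ℓ (kuhnVertex b τ k)) := by
    by_contra hc
    exact hf (if_neg hc)
  have hbox := fun j => Finset.mem_Ico.1 (Fintype.mem_piFinset.1 hb j)
  refine ⟨b, fun i => ⟨(hbox i).1, (hbox i).2.le⟩, fun j hj => ?_⟩
  obtain ⟨k, hk⟩ := hf' j hj
  refine ⟨_, fun i => ?_, fun i => ?_, hk⟩
  · have := hbox i
    simp only [kuhnVertex]
    split_ifs <;> omega
  · simp only [kuhnVertex]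
    split_ifs <;> simp

/-- **Lebesgue covering theorem** for the cube. -/
theorem exists_mem_inter_of_cover_cube {a : ℝ} (ha : 0 < a) (n : ℕ) {ι : Type*}
    (W : ι → Set (Fin n → Set.Icc (0 : ℝ) a)) (hW : ∀ i, IsOpen (W i))
    (hcov : ⋃ i, W i = Set.univ)
    (hopp : ∀ i, ∀ x ∈ W i, ∀ x' ∈ W i, ∀ j, (x j : ℝ) = 0 → (x' j : ℝ) ≠ a) :
    ∃ (x : Fin n → Set.Icc (0 : ℝ) a) (g : Fin (n + 1) → ι),
      Function.Injective g ∧ ∀ k, x ∈ W (g k) := by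
  classical
  obtain ⟨δ, hδ, hball⟩ := lebesgue_number_lemma_of_metric isCompact_univ hW hcov.ge
  choose c hc using fun x => hball x (Set.mem_univ x)
  obtain ⟨N, hN⟩ := exists_nat_gt (a / δ)
  have hN0 : (0 : ℝ) < N := (div_pos ha hδ).trans hN
  have hNδ : a / N < δ := by rwa [div_lt_comm₀ hN0 hδ]
  let p : (Fin n → ℤ) → Fin n → Set.Icc (0 : ℝ) a :=
    fun v i => Set.projIcc 0 a ha.le (v i * (a / N))
  have hp : ∀ v : Fin n → ℤ, (∀ i, 0 ≤ v i ∧ v i ≤ N) → ∀ i, (p v i : ℝ) = v i * (a / N) := by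
    intro v hv i
    have h1 : (0 : ℝ) ≤ v i := by exact_mod_cast (hv i).1
    have h2 : (v i : ℝ) ≤ N := by exact_mod_cast (hv i).2
    have hmem : (v i : ℝ) * (a / N) ∈ Set.Icc 0 a := by
      refine ⟨by positivity, ?_⟩
      calc (v i : ℝ) * (a / N) ≤ N * (a / N) := by gcongr
        _ = a := by field_simp
    simp only [p]
    rw [Set.projIcc_of_mem _ hmem]
  let h : ι → ℕ := fun y =>
    (Finset.univ.filter fun j : Fin n => ∃ x ∈ W y, (x j : ℝ) = 0).sup fun j => (j : ℕ) + 1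
  have hh : ∀ y, h y ≤ n := fun y => Finset.sup_le fun j _ => j.2
  have hmeet : ∀ y (j : Fin n), (∃ x ∈ W y, (x j : ℝ) = 0) → (j : ℕ) + 1 ≤ h y := fun y j hj =>
    Finset.le_sup (f := fun j : Fin n => (j : ℕ) + 1) (by simpa using hj)
  have hnot : ∀ y (j : Fin n), h y = (j : ℕ) + 1 → ∃ x ∈ W y, (x j : ℝ) = 0 := by
    intro y j hj
    have hne : (Finset.univ.filter fun j : Fin n => ∃ x ∈ W y, (x j : ℝ) = 0).Nonempty := by
      by_contra hc
      rw [Finset.not_nonempty_iff_eq_empty] at hc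
      simp only [h, hc, Finset.sup_empty] at hj
      simp at hj
    obtain ⟨i, hi, hi'⟩ := Finset.exists_mem_eq_sup _ hne fun j : Fin n => (j : ℕ) + 1
    have : i = j := Fin.ext (by
      have := hi'.symm.trans hj
      omega)
    subst this
    simpa using hi
  have hself : ∀ x, x ∈ W (c x) := fun x => hc x (Metric.mem_ball_self hδ)
  obtain ⟨b, hb, hfull⟩ := kuhn_exists_full (Nat.cast_pos.1 hN0) n (fun v => n - h (c (p v)))
    (fun v _ => Nat.sub_le _ _)
    (fun v hv j hj => by
      have := hmeet (c (p v)) j ⟨p v, hself _, by rw [hp v hv, hj]; simp⟩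
      have := hh (c (p v))
      omega)
    (fun v hv j hj he => by
      have := hh (c (p v))
      obtain ⟨x, hx, hx0⟩ := hnot (c (p v)) j (by omega)
      refine hopp _ x hx (p v) (hself _) j hx0 ?_
      rw [hp v hv, hj]
      push_cast
      field_simp)
  choose v hv hdist hlab using fun k : Fin (n + 1) => hfull k (Nat.lt_succ_iff.1 k.2)
  refine ⟨p b, fun k => c (p (v k)), fun k k' hk => ?_, fun k => hc _ ?_⟩
  · have h1 := hlab k
    have h2 := hlab k'
    simp only at hk h1 h2
    rw [hk, h2] at h1
    exact Fin.ext h1.symm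
  · rw [Metric.mem_ball]
    refine lt_of_le_of_lt ((dist_pi_le_iff (by positivity)).2 fun i => ?_) hNδ
    rw [Subtype.dist_eq, hp b hb, hp _ (hv k), Real.dist_eq, ← sub_mul, abs_mul,
      abs_of_pos (div_pos ha hN0)]
    have : |(b i : ℝ) - v k i| ≤ 1 := by exact_mod_cast hdist k i
    exact mul_le_of_le_one_left (by positivity) this

theorem exists_open_preimage_dist_lt {X P : Type*} [MetricSpace X] [CompactSpace X]
    [TopologicalSpace P] [T2Space P] {f : X → P} (hf : Continuous f) {a : ℝ} {y : P}
    (hy : Metric.diam (f ⁻¹' {y}) < a) :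
    ∃ U : Set P, IsOpen U ∧ y ∈ U ∧ ∀ x x', f x ∈ U → f x' ∈ U → dist x x' < a := by
  have hC : IsClosed {q : X × X | a ≤ dist q.1 q.2} := isClosed_le continuous_const continuous_dist
  have hK : IsClosed (Prod.map f f '' {q : X × X | a ≤ dist q.1 q.2}) :=
    (hC.isCompact.image (hf.prodMap hf)).isClosed
  have hmem : (y, y) ∈ (Prod.map f f '' {q : X × X | a ≤ dist q.1 q.2})ᶜ := by
    rintro ⟨⟨x, x'⟩, hq, he⟩
    simp only [Prod.map_apply, Prod.mk.injEq] at he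
    have hd := Metric.dist_le_diam_of_mem (s := f ⁻¹' {y}) Metric.isBounded_of_compactSpace
      (show x ∈ f ⁻¹' {y} from he.1) (show x' ∈ f ⁻¹' {y} from he.2)
    exact (hq.trans hd).not_gt hy
  obtain ⟨u, v, hu, hv, hyu, hyv, huv⟩ := isOpen_prod_iff.1 hK.isOpen_compl y y hmem
  refine ⟨u ∩ v, hu.inter hv, ⟨hyu, hyv⟩, fun x x' hx hx' => ?_⟩
  by_contra! hc
  exact huv (Set.mk_mem_prod hx.1 hx'.2) ⟨(x, x'), hc, rfl⟩

theorem le_of_WdimLE_cube {a ε : ℝ} (hε : 0 < ε) (hεa : ε < a) {n m : ℕ}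
    (h : WdimLE (Fin n → Set.Icc (0 : ℝ) a) ε m) : n ≤ m := by
  obtain ⟨P, _, _, _, hdim, f, hf, hdiam⟩ := h
  choose U hUo hyU hU using fun y => exists_open_preimage_dist_lt hf ((hdiam y).trans hεa)
  obtain ⟨V, hVo, hVU, hVcov, hmult⟩ := hdim P U hUo
    (Set.eq_univ_of_forall fun y => Set.mem_iUnion.2 ⟨y, hyU y⟩)
  obtain ⟨x, g, hg, hx⟩ := exists_mem_inter_of_cover_cube (hε.trans hεa) n
    (fun y => f ⁻¹' V y) (fun y => (hVo y).preimage hf)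
    (by rw [← Set.preimage_iUnion, hVcov, Set.preimage_univ])
    (fun y x hx x' hx' j h0 ha => by
      have h1 := (dist_le_pi_dist x x' j).trans_lt (hU y x x' (hVU y hx) (hVU y hx'))
      rw [Subtype.dist_eq, h0, ha, Real.dist_eq, zero_sub, abs_neg] at h1
      exact (le_abs_self a).not_gt h1)
  obtain ⟨hfin, hcard⟩ := hmult (f x)
  have := Set.ncard_le_ncard (Set.range_subset_iff.2 hx : Set.range g ⊆ {y | f x ∈ V y}) hfin
  rw [Set.ncard_range_of_injective hg, Nat.card_fin] at this
  omega

/-- The open star of the lattice point `v` in the Freudenthal triangulation of `ℝⁿ`. -/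
def freudenthalStar {n : ℕ} (v : Fin n → ℤ) : Set (Fin n → ℝ) :=
  {x | (∀ i, |x i - v i| < 1) ∧ ∀ i j, (x i - v i) - (x j - v j) < 1}

theorem isOpen_freudenthalStar {n : ℕ} (v : Fin n → ℤ) : IsOpen (freudenthalStar v) := by
  simp only [freudenthalStar, Set.ofPred_and, Set.ofPred_forall]
  refine (isOpen_iInter_of_finite fun i => isOpen_lt (by fun_prop) (by fun_prop)).inter
    (isOpen_iInter_of_finite fun i => isOpen_iInter_of_finite fun j =>
      isOpen_lt (by fun_prop) (by fun_prop))

theorem mem_freudenthalStar_floor {n : ℕ} (x : Fin n → ℝ) :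
    x ∈ freudenthalStar fun i => ⌊x i⌋ := by
  refine ⟨fun i => ?_, fun i j => ?_⟩
  · rw [abs_lt]
    constructor <;> linarith [Int.floor_le (x i), Int.lt_floor_add_one (x i)]
  · linarith [Int.floor_le (x j), Int.lt_floor_add_one (x i)]

theorem freudenthalStar_multiplicity {n : ℕ} (x : Fin n → ℝ) :
    {v | x ∈ freudenthalStar v}.Finite ∧ {v | x ∈ freudenthalStar v}.ncard ≤ n + 1 := by
  have hcoord : ∀ v, x ∈ freudenthalStar v → ∀ i, ⌊x i⌋ ≤ v i ∧ v i ≤ ⌊x i⌋ + 1 := by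
    intro v hv i
    have := abs_lt.1 (hv.1 i)
    have h1 := Int.floor_le (x i)
    have h2 := Int.lt_floor_add_one (x i)
    constructor
    · rw [← Int.lt_add_one_iff]
      have : (⌊x i⌋ : ℝ) < v i + 1 := by linarith
      exact_mod_cast this
    · rw [← Int.lt_add_one_iff]
      have : (v i : ℝ) < ⌊x i⌋ + 1 + 1 := by linarith
      exact_mod_cast this
  have hchain : ∀ v w, x ∈ freudenthalStar v → x ∈ freudenthalStar w → v ≤ w ∨ w ≤ v := by
    intro v w hv hw
    by_contra! hc
    obtain ⟨h1, h2⟩ := hc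
    simp only [Pi.le_def, not_forall, not_le] at h1 h2
    obtain ⟨i, hi⟩ := h1
    obtain ⟨j, hj⟩ := h2
    have hi' : (w i : ℝ) + 1 ≤ v i := by exact_mod_cast hi
    have hj' : (v j : ℝ) + 1 ≤ w j := by exact_mod_cast hj
    linarith [hv.2 j i, hw.2 i j]
  have hmaps : ∀ v ∈ {v | x ∈ freudenthalStar v},
      ∑ i, v i ∈ (Finset.Icc (∑ i, ⌊x i⌋) (∑ i, ⌊x i⌋ + n) : Set ℤ) := by
    intro v hv
    simp only [Finset.coe_Icc, Set.mem_Icc]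
    refine ⟨Finset.sum_le_sum fun i _ => (hcoord v hv i).1, ?_⟩
    calc ∑ i, v i ≤ ∑ i, (⌊x i⌋ + 1) := Finset.sum_le_sum fun i _ => (hcoord v hv i).2
      _ = ∑ i, ⌊x i⌋ + n := by simp [Finset.sum_add_distrib]
  have hinj : Set.InjOn (fun v : Fin n → ℤ => ∑ i, v i) {v | x ∈ freudenthalStar v} := by
    have key : ∀ v w : Fin n → ℤ, v ≤ w → ∑ i, v i = ∑ i, w i → v = w := fun v w hvw h =>
      funext fun i => (Finset.sum_eq_sum_iff_of_le fun i _ => hvw i).1 h i (Finset.mem_univ i)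
    intro v hv w hw h
    rcases hchain v w hv hw with hvw | hvw
    · exact key v w hvw h
    · exact (key w v hvw h.symm).symm
  refine ⟨Set.Finite.of_injOn hmaps hinj (Finset.finite_toSet _), ?_⟩
  refine (Set.ncard_le_ncard_of_injOn _ hmaps hinj (Finset.finite_toSet _)).trans ?_
  rw [Set.ncard_coe_finset, Int.card_Icc]
  omega

theorem covDimLE_cube {a : ℝ} (ha : 0 < a) (n : ℕ) :
    CovDimLE (Fin n → Set.Icc (0 : ℝ) a) n := by
  intro ι U hU hcov
  obtain ⟨δ, hδ, hball⟩ := lebesgue_number_lemma_of_metric isCompact_univ hU hcov.ge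
  let s : (Fin n → Set.Icc (0 : ℝ) a) → Fin n → ℝ := fun x i => x i * (2 / δ)
  have hs : Continuous s := by fun_prop
  have hsub : ∀ v, ∃ i, s ⁻¹' freudenthalStar v ⊆ U i := by
    intro v
    rcases (s ⁻¹' freudenthalStar v).eq_empty_or_nonempty with he | ⟨x, hx⟩
    · obtain ⟨i, -⟩ := hball (fun _ => ⟨0, le_rfl, ha.le⟩) (Set.mem_univ _)
      exact ⟨i, by simp [he]⟩
    · obtain ⟨i, hi⟩ := hball x (Set.mem_univ _)
      refine ⟨i, fun x' hx' => hi ?_⟩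
      rw [Metric.mem_ball, dist_pi_lt_iff hδ]
      intro j
      have h1 := abs_lt.1 (hx.1 j)
      have h2 := abs_lt.1 (hx'.1 j)
      rw [Subtype.dist_eq, Real.dist_eq]
      have h3 : |((x' j : ℝ) - x j) * (2 / δ)| < 2 := by
        rw [sub_mul, abs_lt]
        simp only [s] at h1 h2
        constructor <;> linarith
      rw [abs_mul, abs_of_pos (by positivity : 0 < 2 / δ), ← lt_div_iff₀ (by positivity),
        div_div_cancel₀ two_ne_zero] at h3
      exact h3
  choose c hc using hsub
  refine ⟨fun i => ⋃ v ∈ c ⁻¹' {i}, s ⁻¹' freudenthalStar v, fun i => ?_, fun i => ?_, ?_,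
    fun x => ?_⟩
  · exact isOpen_biUnion fun v _ => (isOpen_freudenthalStar v).preimage hs
  · exact Set.iUnion₂_subset fun v hv => by
      rw [← show c v = i from hv]
      exact hc v
  · refine Set.eq_univ_of_forall fun x => Set.mem_iUnion.2 ⟨c fun i => ⌊s x i⌋, ?_⟩
    exact Set.mem_biUnion (by simp) (mem_freudenthalStar_floor (s x))
  · obtain ⟨hfin, hcard⟩ := freudenthalStar_multiplicity (s x)
    have hsubset : {i | x ∈ ⋃ v ∈ c ⁻¹' {i}, s ⁻¹' freudenthalStar v} ⊆
        c '' {v | s x ∈ freudenthalStar v} := by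
      intro i hi
      simp only [Set.mem_ofPred_eq, Set.mem_iUnion] at hi
      obtain ⟨v, hv, hxv⟩ := hi
      exact ⟨v, hxv, hv⟩
    have hfin' := hfin.image c
    exact ⟨hfin'.subset hsubset, (Set.ncard_le_ncard hsubset hfin').trans
      ((Set.ncard_image_le hfin).trans hcard)⟩

theorem WdimLE_cube {a ε : ℝ} (ha : 0 < a) (hε : 0 < ε) (n : ℕ) :
    WdimLE (Fin n → Set.Icc (0 : ℝ) a) ε n :=
  ⟨_, inferInstance, inferInstance, inferInstance, covDimLE_cube ha n, id, continuous_id,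
    fun y => by simpa using hε⟩

/-- **Gromov's lemma.** For `0 < ε < a` and `n ∈ ℕ`,
`Wdim_ε([0,a]^n, ‖·‖_∞) = n` (the cube carries the sup metric, which is the product
metric on `(Icc 0 a)^n`). -/
theorem Wdim_cube (a ε : ℝ) (hε : 0 < ε) (hεa : ε < a) (n : ℕ) :
    Wdim (Fin n → (Set.Icc (0 : ℝ) a)) ε = n := by
  refine le_antisymm (sInf_le ⟨n, rfl, WdimLE_cube (hε.trans hεa) hε n⟩) (le_sInf ?_)
  rintro _ ⟨m, rfl, hm⟩
  exact_mod_cast le_of_WdimLE_cube hε hεa hm
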